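/- arXiv:1903.00222 — 4 statements merged into one kernel-verified Lean document; each statement's English description precedes it below -/
import Mathlib

section
/- Let T = (Q, Σ, δ) be an S-automaton and let 𝐪 = q_1 q_2 … q_n ∈ Q⁺ be a nonempty state sequence with reverse 𝐪↩ = q_n … q_2 q_1. Then the following are equivalent: (1) 𝐪↩∘ has torsion in S(T); (2) for every 𝐩 ∈ Q*, the orbit Σ*∘_{∂T}(𝐩𝐪^ω) of the ω-sequence 𝐩𝐪^ω ∈ Q^ω under the action of the dual automaton ∂T is finite; (3) the orbit Σ*∘_{∂T}(𝐪^ω) of 𝐪^ω under the action of ∂T is finite. -/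
/- Common framework for automaton semigroups acting on finite and infinite words.

An S-automaton over states `Q` and alphabet `A` is given by a partial deterministic
transition function `δ : Q → A → Option (A × Q)` (with `δ q a = some (b, p)` encoding
the transition `q –a/b→ p`). -/

namespace AutOrbit

variable {Q A : Type*}

/-- The partial action `q∘` of a single state on a finite word. -/
def stateAct (δ : Q → A → Option (A × Q)) : Q → List A → Option (List A)
  | _, [] => some []
  | q, a :: u => (δ q a).bind fun bp => (stateAct δ bp.2 u).map fun v => bp.1 :: v

/-- The partial action `𝐪∘` of a state sequence `𝐪 = q_n … q_1` (written left-to-right,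
head of the list is `q_n`; the rightmost state `q_1` is applied first). -/
def seqAct (δ : Q → A → Option (A × Q)) (l : List Q) (u : List A) : Option (List A) :=
  l.foldr (fun q acc => acc.bind (stateAct δ q)) (some u)

/-- The length-`n` prefix of an ω-word. -/
def pre (ξ : ℕ → A) (n : ℕ) : List A := List.ofFn fun i : Fin n => ξ i

/-- The `L`-orbit `L∘u` of a finite word `u`. -/
def orbit (δ : Q → A → Option (A × Q)) (L : Set (List Q)) (u : List A) : Set (List A) :=
  {v | ∃ l ∈ L, seqAct δ l u = some v}

/-- The `L`-orbit `L∘ξ` of an ω-word `ξ`: all ω-words `η` such that some `𝐪 ∈ L` is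
defined on `ξ` with `𝐪∘ξ = η` (i.e. `𝐪∘` maps every prefix of `ξ` to the
corresponding prefix of `η`). -/
def omegaOrbit (δ : Q → A → Option (A × Q)) (L : Set (List Q)) (ξ : ℕ → A) :
    Set (ℕ → A) :=
  {η | ∃ l ∈ L, ∀ n, seqAct δ l (pre ξ n) = some (pre η n)}

/-- The set of partial maps `L∘ = {𝐪∘ ∣ 𝐪 ∈ L}`. -/
def mapsOf (δ : Q → A → Option (A × Q)) (L : Set (List Q)) :
    Set (List A → Option (List A)) :=
  {f | ∃ l ∈ L, f = seqAct δ l}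

/-- `L ⊆ F*` is suffix-closed over `F`: every `𝐪 ∈ L` factorizes into factors from `F`
such that every suffix (as a word over the alphabet `F`) of the factorization is
again in `L`. -/
def SuffixClosedOver (F L : Set (List Q)) : Prop :=
  ∀ l ∈ L, ∃ fs : List (List Q),
    (∀ f ∈ fs, f ∈ F) ∧ fs.flatten = l ∧ ∀ i, (fs.drop i).flatten ∈ L

/-- `L` is finitely suffix-closed: suffix-closed over some finite nonempty `F ⊆ Q*`. -/
def FinitelySuffixClosed (L : Set (List Q)) : Prop :=
  ∃ F : Set (List Q), F.Finite ∧ F.Nonempty ∧ SuffixClosedOver F L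

/-- `u` has infinite potential w.r.t. `δ` and `L`: the orbit sizes `|L∘ux|` are unbounded. -/
def InfinitePotential (δ : Q → A → Option (A × Q)) (L : Set (List Q)) (u : List A) : Prop :=
  ∀ C : ℕ, ∃ x : List A, C < (orbit δ L (u ++ x)).ncard

/-- The `i`-th power `𝐪^i` of a state sequence. -/
def listPow (l : List Q) (i : ℕ) : List Q := (List.replicate i l).flatten

/-- `𝐪∘` has torsion: two distinct positive powers induce the same partial map. -/
def HasTorsion (δ : Q → A → Option (A × Q)) (l : List Q) : Prop :=
  ∃ i j : ℕ, 1 ≤ i ∧ 1 ≤ j ∧ i ≠ j ∧ seqAct δ (listPow l i) = seqAct δ (listPow l j)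

/-- The automaton is complete: `δ` is total. -/
def Complete (δ : Q → A → Option (A × Q)) : Prop := ∀ q a, (δ q a).isSome

/-- The automaton is invertible: for every state, the letter-to-output-letter map is a
bijection of the alphabet (each output letter is produced by exactly one input letter). -/
def Invertible (δ : Q → A → Option (A × Q)) : Prop :=
  ∀ q b, ∃! a, ∃ p, δ q a = some (b, p)

/-- A G-automaton: a complete invertible S-automaton. -/
def GAutomaton (δ : Q → A → Option (A × Q)) : Prop := Complete δ ∧ Invertible δ

/-- Reversibility: for every input letter `a` and target state `p` there is at most one
transition `q –a/b→ p`. -/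
def Reversible (δ : Q → A → Option (A × Q)) : Prop :=
  ∀ a p q₁ b₁ q₂ b₂, δ q₁ a = some (b₁, p) → δ q₂ a = some (b₂, p) → q₁ = q₂

/-- Reversibility of the inverse automaton: for every output letter `b` and target
state `p` there is at most one transition `q –a/b→ p`. -/
def InvReversible (δ : Q → A → Option (A × Q)) : Prop :=
  ∀ b p q₁ a₁ q₂ a₂, δ q₁ a₁ = some (b, p) → δ q₂ a₂ = some (b, p) → q₁ = q₂ ∧ a₁ = a₂

/-- Bi-reversibility: the automaton and its inverse automaton are both reversible. -/
def BiReversible (δ : Q → A → Option (A × Q)) : Prop := Reversible δ ∧ InvReversible δ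

/-- The dual automaton `∂T`: states are letters, letters are states; it has a transition
`a –q/p→ b` for every transition `q –a/b→ p` of `T`. -/
def dual (δ : Q → A → Option (A × Q)) : A → Q → Option (Q × A) :=
  fun a q => (δ q a).map fun bp => (bp.2, bp.1)

/-- Adjacency of states in the underlying undirected graph of the automaton. -/
def Adj (δ : Q → A → Option (A × Q)) (q p : Q) : Prop :=
  (∃ a b, δ q a = some (b, p)) ∨ (∃ a b, δ p a = some (b, q))

/-- `P` is (the state set of) a connected component of the automaton. -/
def IsComponent (δ : Q → A → Option (A × Q)) (P : Set Q) : Prop :=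
  ∃ q, P = {p | Relation.ReflTransGen (Adj δ) q p}

/-- The sub-automaton induced on `P` (with all transitions among states of `P`)
is reversible. -/
def SubReversible (δ : Q → A → Option (A × Q)) (P : Set Q) : Prop :=
  ∀ a : A, ∀ p ∈ P, ∀ q₁ b₁ q₂ b₂, q₁ ∈ P → q₂ ∈ P →
    δ q₁ a = some (b₁, p) → δ q₂ a = some (b₂, p) → q₁ = q₂

/-- The inverse of the sub-automaton induced on `P` is reversible. -/
def SubInvReversible (δ : Q → A → Option (A × Q)) (P : Set Q) : Prop :=
  ∀ b : A, ∀ p ∈ P, ∀ q₁ a₁ q₂ a₂, q₁ ∈ P → q₂ ∈ P →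
    δ q₁ a₁ = some (b, p) → δ q₂ a₂ = some (b, p) → q₁ = q₂ ∧ a₁ = a₂

/-- The sub-automaton induced on `P` is bi-reversible. -/
def SubBiReversible (δ : Q → A → Option (A × Q)) (P : Set Q) : Prop :=
  SubReversible δ P ∧ SubInvReversible δ P

/-- For a complete automaton, the (total) action of a state on a finite word. -/
noncomputable def totAct (δ : Q → A → Option (A × Q)) (q : Q) (u : List A) : List A :=
  (stateAct δ q u).getD u

/-- The action of a state of the automaton (`Sum.inl`) or of its inverse automaton
(`Sum.inr`): for a G-automaton, `totAct δ q` is a bijection of `Σ*` and the inverse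
state `q̄` acts as its inverse bijection. -/
noncomputable def gAct (δ : Q → A → Option (A × Q)) : Q ⊕ Q → List A → List A
  | Sum.inl q => totAct δ q
  | Sum.inr q => Function.invFun (totAct δ q)

/-- Action of a sequence over `Q ⊔ Q̄` (rightmost entry applied first). -/
noncomputable def gSeqAct (δ : Q → A → Option (A × Q)) (l : List (Q ⊕ Q)) (u : List A) :
    List A :=
  l.foldr (fun s v => gAct δ s v) u

/-- The automaton group `G(T) = {𝐪∘ ∣ 𝐪 ∈ (Q ⊔ Q̄)⁺}` as a set of maps on `Σ*`. -/
def autGroup (δ : Q → A → Option (A × Q)) : Set (List A → List A) :=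
  {f | ∃ l : List (Q ⊕ Q), l ≠ [] ∧ f = gSeqAct δ l}

/-- The ultimately periodic ω-word `u (a v)^ω`. -/
def ultPer (u : List A) (a : A) (v : List A) (n : ℕ) : A :=
  if h : n < u.length then u.get ⟨n, h⟩
  else (a :: v).get ⟨(n - u.length) % (a :: v).length, Nat.mod_lt _ (by simp)⟩

/-- Run of a single state on a word, returning the output word and the final state. -/
def runState (δ : Q → A → Option (A × Q)) : Q → List A → Option (List A × Q)
  | q, [] => some ([], q)
  | q, a :: u => (δ q a).bind fun bp =>
      (runState δ bp.2 u).map fun vr => (bp.1 :: vr.1, vr.2)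

/-- Run of a state sequence `𝐪` on a word `u`, returning the output word `𝐪∘u` and the
residual state sequence `𝐪·u` (the dual action). -/
def runSeq (δ : Q → A → Option (A × Q)) : List Q → List A → Option (List A × List Q)
  | [], u => some (u, [])
  | q :: l, u => (runSeq δ l u).bind fun vr =>
      (runState δ q vr.1).map fun wp => (wp.1, wp.2 :: vr.2)

/-- Nodes of the `L`-orbital transducer over `F` of `u`: words reached from `u` along a
path of `F`-labeled edges whose reverse label (a word over `F`) lies in `L`. -/
def transNodes (δ : Q → A → Option (A × Q)) (F L : Set (List Q)) (u : List A) :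
    Set (List A) :=
  {v | ∃ fs : List (List Q), (∀ f ∈ fs, f ∈ F) ∧ fs.flatten ∈ L ∧
        ∃ r, runSeq δ fs.flatten u = some (v, r)}

/-- Edges of the `L`-orbital transducer over `F` of `u`: an edge `v –𝐩/𝐨→ w` with
`𝐩 ∈ F`, input label `𝐩`, output label `𝐨 = 𝐩·v`, lying on a path from `u` whose
reverse label is in `L`. -/
def transEdge (δ : Q → A → Option (A × Q)) (F L : Set (List Q)) (u : List A)
    (v : List A) (p o : List Q) (w : List A) : Prop :=
  p ∈ F ∧ ∃ fs : List (List Q), (∀ f ∈ fs, f ∈ F) ∧ (p :: fs).flatten ∈ L ∧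
    (∃ r, runSeq δ fs.flatten u = some (v, r)) ∧ runSeq δ p v = some (w, o)

/-- Isomorphism of the `L`-orbital transducers over `F` of `u₁` and `u₂`: a bijection of
the node sets mapping `u₁` to `u₂` and preserving labeled edges in both directions. -/
def TransducerIso (δ : Q → A → Option (A × Q)) (F L : Set (List Q)) (u₁ u₂ : List A) :
    Prop :=
  ∃ φ : List A → List A,
    Set.BijOn φ (transNodes δ F L u₁) (transNodes δ F L u₂) ∧ φ u₁ = u₂ ∧
    ∀ v ∈ transNodes δ F L u₁, ∀ w ∈ transNodes δ F L u₁, ∀ p o : List Q,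
      (transEdge δ F L u₁ v p o w ↔ transEdge δ F L u₂ (φ v) p o (φ w))


@[simp]
theorem seqAct_nil (δ : Q → A → Option (A × Q)) (u : List A) : seqAct δ [] u = some u := rfl

theorem seqAct_cons (δ : Q → A → Option (A × Q)) (q : Q) (l : List Q) (u : List A) :
    seqAct δ (q :: l) u = (seqAct δ l u).bind (stateAct δ q) := rfl

theorem seqAct_append (δ : Q → A → Option (A × Q)) (l m : List Q) (u : List A) :
    seqAct δ (l ++ m) u = (seqAct δ m u).bind (seqAct δ l) := by
  induction l with
  | nil => cases h : seqAct δ m u <;> simp [h]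
  | cons q l ih =>
    rw [List.cons_append, seqAct_cons, ih, Option.bind_assoc]
    rfl

theorem seqAct_concat (δ : Q → A → Option (A × Q)) (l : List Q) (q : Q) (u : List A) :
    seqAct δ (l ++ [q]) u = (stateAct δ q u).bind (seqAct δ l) := by
  simp [seqAct_append, seqAct_cons]

theorem seqAct_empty_word (δ : Q → A → Option (A × Q)) (l : List Q) :
    seqAct δ l [] = some [] := by
  induction l with
  | nil => rfl
  | cons q l ih => simp [seqAct_cons, ih, stateAct]

theorem stateAct_eq_map_runState (δ : Q → A → Option (A × Q)) (q : Q) (u : List A) :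
    stateAct δ q u = (runState δ q u).map Prod.fst := by
  induction u generalizing q with
  | nil => rfl
  | cons a u ih =>
    cases h : δ q a <;> simp [stateAct, runState, h, ih, Function.comp_def]

theorem runState_append (δ : Q → A → Option (A × Q)) (q : Q) (u v : List A) :
    runState δ q (u ++ v) = (runState δ q u).bind fun xp =>
      (runState δ xp.2 v).map fun yr => (xp.1 ++ yr.1, yr.2) := by
  induction u generalizing q with
  | nil => simp [runState]
  | cons a u ih =>
    cases h : δ q a with
    | none => simp [runState, h]
    | some bp =>
      cases h' : runState δ bp.2 u <;> simp [runState, h, ih, h', Function.comp_def]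

theorem dual_dual (δ : Q → A → Option (A × Q)) : dual (dual δ) = δ := by
  funext q a
  simp [dual, Function.comp_def]

/-- Cross diagram: a state sequence acts on the first letter through the dual run of that letter,
and on the rest of the word through the output of this run. -/
theorem seqAct_reverse_cons (δ : Q → A → Option (A × Q)) (s : List Q) (a : A) (v : List A) :
    seqAct δ s.reverse (a :: v) = (runState (dual δ) a s).bind fun tb =>
      (seqAct δ tb.1.reverse v).map fun w => tb.2 :: w := by
  induction s generalizing a v with
  | nil => simp [runState]
  | cons q s ih =>
    cases h : δ q a with
    | none => simp [seqAct_concat, stateAct, runState, dual, h]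
    | some bp =>
      cases h' : stateAct δ bp.2 v <;> cases h'' : runState (dual δ) bp.1 s <;>
        simp [seqAct_concat, stateAct, runState, dual, h, h', ih] <;>
        simp_all [seqAct_concat]

theorem seqAct_dual_append (δ : Q → A → Option (A × Q)) (u : List A) (s t : List Q) :
    seqAct (dual δ) u.reverse (s ++ t) = (seqAct (dual δ) u.reverse s).bind fun v =>
      (seqAct δ s.reverse u).bind fun x =>
        (seqAct (dual δ) x.reverse t).map fun w => v ++ w := by
  induction s generalizing u with
  | nil => simp [seqAct_empty_word]
  | cons q s ih =>
    simp only [List.cons_append, seqAct_reverse_cons, dual_dual, List.reverse_cons,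
      seqAct_concat, stateAct_eq_map_runState]
    cases h : runState δ q u with
    | none => simp
    | some yp =>
      cases h' : seqAct (dual δ) yp.1.reverse s <;>
        cases h'' : seqAct δ s.reverse yp.1 <;> simp [ih, h', h'', Function.comp_def]

theorem pre_eq_map_range (ξ : ℕ → A) (n : ℕ) : pre ξ n = (List.range n).map ξ := by
  apply List.ext_getElem <;> simp [pre]

@[simp]
theorem length_pre (ξ : ℕ → A) (n : ℕ) : (pre ξ n).length = n := by simp [pre]

theorem pre_add (ξ : ℕ → A) (m n : ℕ) :
    pre ξ (m + n) = pre ξ m ++ pre (fun k => ξ (m + k)) n := by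
  simp [pre_eq_map_range, List.range_add, Function.comp_def]

theorem pre_succ (ξ : ℕ → A) (n : ℕ) : pre ξ (n + 1) = pre ξ n ++ [ξ n] := by
  simp [pre_eq_map_range, List.range_succ]

theorem reverse_listPow (l : List Q) (i : ℕ) : (listPow l i).reverse = listPow l.reverse i := by
  simp [listPow, List.reverse_flatten]

/-- Prefixes of a periodic word. -/
theorem pre_periodic {l : List Q} {ψ : ℕ → Q} (hψ : ∀ n : ℕ, l[n % l.length]? = some (ψ n))
    (i : ℕ) : pre ψ (i * l.length) = listPow l i := by
  induction i with
  | zero => simp [pre, listPow]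
  | succ i ih =>
    have hper : (fun k => ψ (l.length + k)) = ψ := by
      funext k
      apply Option.some.inj
      rw [← hψ, ← hψ, Nat.add_mod_left]
    have hl : pre ψ l.length = l := by
      refine List.ext_getElem (by simp) fun k _ hk => ?_
      have := hψ k
      rw [Nat.mod_eq_of_lt hk, List.getElem?_eq_getElem hk] at this
      simpa [pre] using (Option.some.inj this).symm
    rw [Nat.succ_mul, Nat.add_comm, pre_add, hper, ih, hl]
    simp [listPow, List.replicate_succ]

/-- Prefixes of an ultimately periodic word. -/
theorem pre_ultimately_periodic {l p : List Q} {ψ φ : ℕ → Q}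
    (hψ : ∀ n : ℕ, l[n % l.length]? = some (ψ n))
    (hφ : ∀ n : ℕ, (if n < p.length then p[n]? else l[(n - p.length) % l.length]?) = some (φ n))
    (i k : ℕ) :
    pre φ (p.length + i * l.length + k) = (p ++ listPow l i) ++ pre ψ k := by
  have hp : pre φ p.length = p := by
    refine List.ext_getElem (by simp) fun k _ hk => ?_
    have := hφ k
    rw [if_pos hk, List.getElem?_eq_getElem hk] at this
    simpa [pre] using (Option.some.inj this).symm
  have hs : (fun k => φ (p.length + k)) = ψ := by
    funext k
    apply Option.some.inj
    rw [← hψ, ← hφ, if_neg (by omega), Nat.add_sub_cancel_left]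
  have hper : (fun k => ψ (i * l.length + k)) = ψ := by
    funext k
    apply Option.some.inj
    rw [← hψ, ← hψ, Nat.mul_add_mod_self_right]
  rw [Nat.add_assoc, pre_add, hp, hs, pre_add, hper, pre_periodic hψ, List.append_assoc]

/-- The sequences satisfying a fixed eventual periodicity over a finite set are finitely many. -/
theorem finite_setOf_eventually_periodic [Finite Q] {m n : ℕ} (hmn : m < n) :
    {η : ℕ → Q | ∀ k, η (m + k) = η (n + k)}.Finite := by
  refine Set.Finite.of_finite_image (f := fun η (i : Fin n) => η i) (Set.toFinite _) ?_
  intro η hη ζ hζ h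
  funext k
  induction k using Nat.strong_induction_on with
  | _ k ih =>
    by_cases hk : k < n
    · exact congrFun h ⟨k, hk⟩
    · obtain ⟨c, rfl⟩ := Nat.exists_eq_add_of_le (not_lt.mp hk)
      rw [← hη c, ← hζ c]
      exact ih _ (by omega)

theorem omegaOrbit_dual_subset_of_seqAct_eq (δ : Q → A → Option (A × Q)) {φ ψ : ℕ → Q} {m n : ℕ}
    {s t : List Q} (hs : ∀ k, pre φ (m + k) = s ++ pre ψ k)
    (ht : ∀ k, pre φ (n + k) = t ++ pre ψ k) (hst : seqAct δ s.reverse = seqAct δ t.reverse) :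
    omegaOrbit (dual δ) Set.univ φ ⊆ {η | ∀ k, η (m + k) = η (n + k)} := by
  rintro η ⟨u, -, hu⟩ k
  have split : ∀ {m : ℕ} {s : List Q}, (∀ k, pre φ (m + k) = s ++ pre ψ k) →
      ∃ x, seqAct δ s.reverse u.reverse = some x ∧
        seqAct (dual δ) x.reverse (pre ψ (k + 1)) =
          some (pre (fun j => η (m + j)) (k + 1)) := by
    intro m s h
    have h1 := hu (m + (k + 1))
    have h0 := hu (m + 0)
    rw [h] at h0 h1
    rw [← List.reverse_reverse u, seqAct_dual_append] at h1
    simp only [pre, List.ofFn_zero, List.append_nil, Nat.add_zero] at h0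
    rw [List.reverse_reverse, h0] at h1
    simp only [Option.bind_some, Option.bind_eq_some_iff, Option.map_eq_some_iff] at h1
    obtain ⟨x, hx, w, hw, e⟩ := h1
    refine ⟨x, hx, hw.trans ?_⟩
    rw [pre_add] at e
    exact congrArg some (List.append_cancel_left e)
  obtain ⟨x, hx, hx'⟩ := split hs
  obtain ⟨y, hy, hy'⟩ := split ht
  obtain rfl : x = y := Option.some.inj (by rw [← hx, ← hy, hst])
  have e := Option.some.inj (hx'.symm.trans hy')
  rw [pre_succ, pre_succ] at e
  simpa using (List.append_inj e (by simp)).2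

theorem HasTorsion.finite_omegaOrbit_dual [Finite Q] {δ : Q → A → Option (A × Q)} {l : List Q}
    (hl : l ≠ []) {ψ : ℕ → Q} (hψ : ∀ n : ℕ, l[n % l.length]? = some (ψ n))
    (htor : HasTorsion δ l.reverse) {p : List Q} {φ : ℕ → Q}
    (hφ : ∀ n : ℕ, (if n < p.length then p[n]? else l[(n - p.length) % l.length]?) = some (φ n)) :
    (omegaOrbit (dual δ) (Set.univ : Set (List A)) φ).Finite := by
  obtain ⟨i, j, -, -, hij, h⟩ := htor
  wlog hlt : i < j generalizing i j
  · exact this j i hij.symm h.symm (by omega)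
  have hlen : 0 < l.length := List.length_pos_of_ne_nil hl
  refine (finite_setOf_eventually_periodic (Nat.add_lt_add_left
    (Nat.mul_lt_mul_of_pos_right hlt hlen) p.length)).subset
    (omegaOrbit_dual_subset_of_seqAct_eq δ (pre_ultimately_periodic hψ hφ i)
      (pre_ultimately_periodic hψ hφ j) ?_)
  funext u
  simp only [List.reverse_append, seqAct_append, reverse_listPow, h]

/-- A state that is defined on every prefix of an infinite word is defined on that word. -/
theorem exists_stateAct_pre_eq {δ : Q → A → Option (A × Q)} {q : Q} {ξ : ℕ → A}
    (h : ∀ n, runState δ q (pre ξ n) ≠ none) :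
    ∃ η : ℕ → A, ∀ n, stateAct δ q (pre ξ n) = some (pre η n) := by
  choose x hx using fun n => Option.ne_none_iff_exists'.mp (h n)
  have hstep : ∀ n, ∃ b, (x (n + 1)).1 = (x n).1 ++ [b] := by
    intro n
    have := hx (n + 1)
    rw [pre_succ, runState_append, hx n] at this
    cases hd : δ (x n).2 (ξ n) with
    | none => simp [runState, hd] at this
    | some bp =>
      simp [runState, hd] at this
      exact ⟨bp.1, by rw [← this]⟩
  choose η hη using hstep
  refine ⟨η, fun n => ?_⟩
  rw [stateAct_eq_map_runState, hx, Option.map_some]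
  congr 1
  induction n with
  | zero =>
    have := hx 0
    simp [pre, runState] at this
    simp [pre, ← this]
  | succ n ih => rw [hη, ih, pre_succ]

theorem runState_pre_eq_none_of_le {δ : Q → A → Option (A × Q)} {q : Q} {ξ : ℕ → A} {m n : ℕ}
    (hmn : m ≤ n) (h : runState δ q (pre ξ m) = none) : runState δ q (pre ξ n) = none := by
  obtain ⟨k, rfl⟩ := Nat.exists_eq_add_of_le hmn
  rw [pre_add, runState_append, h, Option.bind_none]

/-- Two prefix lengths of the words in a dual-invariant set of infinite words induce the same
partial maps as soon as they agree on single letters and all undefined runs have stopped. -/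
theorem seqAct_pre_reverse_eq {δ : Q → A → Option (A × Q)} {O : Set (ℕ → Q)}
    (hO : ∀ η ∈ O, ∀ a ζ, (∀ n, stateAct (dual δ) a (pre η n) = some (pre ζ n)) → ζ ∈ O)
    {m n : ℕ}
    (hdead : ∀ η ∈ O, ∀ a, (∀ k, runState (dual δ) a (pre η k) ≠ none) ∨
      runState (dual δ) a (pre η m) = none ∧ runState (dual δ) a (pre η n) = none)
    (hlet : ∀ η ∈ O, ∀ a, (runState (dual δ) a (pre η m)).map Prod.snd =
      (runState (dual δ) a (pre η n)).map Prod.snd)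
    (w : List A) : ∀ η ∈ O, seqAct δ (pre η m).reverse w = seqAct δ (pre η n).reverse w := by
  induction w with
  | nil => simp [seqAct_empty_word]
  | cons a w ih =>
    intro η hη
    rw [seqAct_reverse_cons, seqAct_reverse_cons]
    rcases hdead η hη a with h | ⟨hm, hn⟩
    · obtain ⟨ζ, hζ⟩ := exists_stateAct_pre_eq h
      have hlet := hlet η hη a
      obtain ⟨x, hx⟩ := Option.ne_none_iff_exists'.mp (h m)
      obtain ⟨y, hy⟩ := Option.ne_none_iff_exists'.mp (h n)
      have hzm := hζ m
      have hzn := hζ n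
      simp only [stateAct_eq_map_runState, hx, hy, Option.map_some, Option.some.injEq]
        at hzm hzn hlet
      simp only [hx, hy, Option.bind_some, hzm, hzn, hlet, ih ζ (hO η hη a ζ hζ)]
    · rw [hm, hn]

theorem hasTorsion_of_finite_omegaOrbit_dual [Finite A] {δ : Q → A → Option (A × Q)} {l : List Q}
    (hl : l ≠ []) {ψ : ℕ → Q} (hψ : ∀ n : ℕ, l[n % l.length]? = some (ψ n))
    (hfin : (omegaOrbit (dual δ) (Set.univ : Set (List A)) ψ).Finite) :
    HasTorsion δ l.reverse := by
  set O := omegaOrbit (dual δ) (Set.univ : Set (List A)) ψ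
  have hO : ∀ η ∈ O, ∀ a ζ, (∀ n, stateAct (dual δ) a (pre η n) = some (pre ζ n)) → ζ ∈ O := by
    rintro η ⟨u, -, hu⟩ a ζ hζ
    exact ⟨a :: u, trivial, fun n => by rw [seqAct_cons, hu, Option.bind_some, hζ]⟩
  have hψO : ψ ∈ O := ⟨[], trivial, fun n => rfl⟩
  have hdead : ∀ᶠ n in Filter.atTop, ∀ η ∈ O, ∀ a,
      (∀ k, runState (dual δ) a (pre η k) ≠ none) ∨ runState (dual δ) a (pre η n) = none := by
    rw [Filter.eventually_all_finite hfin]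
    intro η _
    rw [Filter.eventually_all]
    intro a
    by_cases h : ∀ k, runState (dual δ) a (pre η k) ≠ none
    · exact Filter.Eventually.of_forall fun _ => Or.inl h
    · push Not at h
      obtain ⟨k, hk⟩ := h
      filter_upwards [Filter.eventually_ge_atTop k] with n hn
      exact Or.inr (runState_pre_eq_none_of_le hn hk)
  obtain ⟨N, hN⟩ := Filter.eventually_atTop.mp hdead
  have hlen : 0 < l.length := List.length_pos_of_ne_nil hl
  have hge : ∀ i, N ≤ (N + 1 + i) * l.length := fun i =>
    le_trans (by omega) (Nat.le_mul_of_pos_right _ hlen)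
  have : Finite O := hfin
  obtain ⟨i, j, hij, h⟩ := Finite.exists_ne_map_eq_of_infinite
    fun (i : ℕ) (η : O) (a : A) =>
      (runState (dual δ) a (pre η.1 ((N + 1 + i) * l.length))).map Prod.snd
  refine ⟨N + 1 + i, N + 1 + j, by omega, by omega, by omega, ?_⟩
  funext w
  rw [← reverse_listPow, ← reverse_listPow, ← pre_periodic hψ, ← pre_periodic hψ]
  refine seqAct_pre_reverse_eq hO (fun η hη a => ?_)
    (fun η hη a => congrFun (congrFun h ⟨η, hη⟩) a) w ψ hψO
  rcases hN _ (hge i) η hη a with h | h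
  · exact Or.inl h
  · exact (hN _ (hge j) η hη a).imp_right fun h' => ⟨h, h'⟩

/-- For a nonempty state sequence `𝐪 = q₁ … q_n` (the list `l`, written
left-to-right) with reverse `𝐪↩ = q_n … q₁`, the following are equivalent:
(1) `𝐪↩∘` has torsion in `S(T)`;
(2) the orbit under the dual automaton `∂T` of every ultimately periodic word `𝐩𝐪^ω`
    is finite;
(3) the orbit under `∂T` of the periodic word `𝐪^ω` is finite. -/
theorem torsion_iff_finite_dual_orbit {Q A : Type*} [Fintype Q] [Fintype A] [Nonempty A]
    (δ : Q → A → Option (A × Q)) (l : List Q) (hl : l ≠ [])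
    (ψ : ℕ → Q) (hψ : ∀ n : ℕ, l[n % l.length]? = some (ψ n)) :
    (HasTorsion δ l.reverse ↔
      ∀ (p : List Q) (φ : ℕ → Q),
        (∀ n : ℕ, (if n < p.length then p[n]?
          else l[(n - p.length) % l.length]?) = some (φ n)) →
        (omegaOrbit (dual δ) (Set.univ : Set (List A)) φ).Finite) ∧
    (HasTorsion δ l.reverse ↔
      (omegaOrbit (dual δ) (Set.univ : Set (List A)) ψ).Finite) := by
  have h12 : HasTorsion δ l.reverse → ∀ (p : List Q) (φ : ℕ → Q),
      (∀ n : ℕ, (if n < p.length then p[n]?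
        else l[(n - p.length) % l.length]?) = some (φ n)) →
      (omegaOrbit (dual δ) (Set.univ : Set (List A)) φ).Finite :=
    fun h _ _ hφ => h.finite_omegaOrbit_dual hl hψ hφ
  have h31 := hasTorsion_of_finite_omegaOrbit_dual (δ := δ) hl hψ
  exact ⟨⟨h12, fun h => h31 (h [] ψ (by simpa using hψ))⟩,
    ⟨fun h => h12 h [] ψ (by simpa using hψ), h31⟩⟩

end AutOrbit
end

section
/- Let T = (Q, Σ, δ) be a reversible G-automaton having a non-bi-reversible (strongly) connected component whose set of states is P ⊆ Q. Then {𝐪∘ ∣ 𝐪 ∈ Q⁺} does not contain the inverse of p∘ for any p ∈ P; i.e., there is no p ∈ P and 𝐪 ∈ Q⁺ with 𝐪∘ equal to the inverse bijection (p∘)⁻¹ of Σ*. -/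
/- Common framework for automaton semigroups acting on finite and infinite words.

An S-automaton over states `Q` and alphabet `A` is given by a partial deterministic
transition function `δ : Q → A → Option (A × Q)` (with `δ q a = some (b, p)` encoding
the transition `q –a/b→ p`). -/

namespace AutOrbit

variable {Q A : Type*}

/-- One step of the dual action of a complete automaton with output function `out` and
successor function `nxt`: the output letter and the residual state sequence. -/
def stepSeq (out : Q → A → A) (nxt : Q → A → Q) : List Q → A → A × List Q
  | [], b => (b, [])
  | q :: l, b =>
      (out q (stepSeq out nxt l b).1, nxt q (stepSeq out nxt l b).1 :: (stepSeq out nxt l b).2)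

section StepSeq

variable {out : Q → A → A} {nxt : Q → A → Q}

theorem length_stepSeq_snd (l : List Q) (b : A) :
    (stepSeq out nxt l b).2.length = l.length := by
  induction l with
  | nil => rfl
  | cons q l ih => simp [stepSeq, ih]

theorem stepSeq_snd_injective (hnxt : ∀ a, Function.Injective fun q => nxt q a) (b : A) :
    Function.Injective fun l => (stepSeq out nxt l b).2 := by
  intro l
  induction l with
  | nil =>
    intro l' h
    cases l' with
    | nil => rfl
    | cons q' l' => simp [stepSeq] at h
  | cons q l ih =>
    intro l' h
    cases l' with
    | nil => simp [stepSeq] at h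
    | cons q' l' =>
      simp only [stepSeq, List.cons.injEq] at h
      obtain rfl := ih h.2
      rw [hnxt _ h.1]

theorem seqAct_cons_word {δ : Q → A → Option (A × Q)}
    (hδ : ∀ q a, δ q a = some (out q a, nxt q a)) (l : List Q) (b : A) (u : List A) :
    seqAct δ l (b :: u) =
      (seqAct δ (stepSeq out nxt l b).2 u).map ((stepSeq out nxt l b).1 :: ·) := by
  induction l with
  | nil => rfl
  | cons q l ih =>
    simp only [seqAct, List.foldr_cons, stepSeq] at ih ⊢
    rw [ih]
    cases List.foldr (fun q acc => acc.bind (stateAct δ q)) (some u) (stepSeq out nxt l b).2 with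
    | none => rfl
    | some v => simp [stateAct, hδ]

/-- If a state sequence acts as the identity, then it fixes every letter and all its
residuals act as the identity. -/
theorem stepSeq_of_seqAct_eq_id {δ : Q → A → Option (A × Q)}
    (hδ : ∀ q a, δ q a = some (out q a, nxt q a)) {l : List Q}
    (hl : ∀ u, seqAct δ l u = some u) (b : A) :
    (stepSeq out nxt l b).1 = b ∧ ∀ u, seqAct δ (stepSeq out nxt l b).2 u = some u := by
  have key : ∀ u, seqAct δ (stepSeq out nxt l b).2 u = some u ∧ (stepSeq out nxt l b).1 = b := by
    intro u
    have h := hl (b :: u)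
    rw [seqAct_cons_word hδ, Option.map_eq_some_iff] at h
    obtain ⟨v, hv, h⟩ := h
    rw [List.cons.injEq] at h
    exact ⟨h.2 ▸ hv, h.1⟩
  exact ⟨(key []).2, fun u => (key u).1⟩

end StepSeq

/-- A set of states closed under transitions contains every component it meets, provided
the automaton is finite, complete and reversible. -/
theorem mem_of_reflTransGen_adj [Finite Q] {δ : Q → A → Option (A × Q)} {out : Q → A → A}
    {nxt : Q → A → Q} (hδ : ∀ q a, δ q a = some (out q a, nxt q a))
    (hnxt : ∀ a, Function.Injective fun q => nxt q a) {R : Set Q}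
    (hR : ∀ q ∈ R, ∀ a, nxt q a ∈ R) {q r : Q} (h : Relation.ReflTransGen (Adj δ) q r) :
    q ∈ R ↔ r ∈ R := by
  have step : ∀ q a, nxt q a ∈ R ↔ q ∈ R := by
    refine fun q a => ⟨fun h => ?_, fun h => hR q h a⟩
    have hbij : Set.BijOn (fun q => nxt q a) R R :=
      (R.toFinite.injOn_iff_bijOn_of_mapsTo fun q hq => hR q hq a).1 (hnxt a).injOn
    obtain ⟨q', hq', e⟩ := hbij.surjOn h
    exact hnxt a e ▸ hq'
  induction h with
  | refl => rfl
  | tail _ hadj ih =>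
    refine ih.trans ?_
    rcases hadj with ⟨a, b, h⟩ | ⟨a, b, h⟩ <;> rw [hδ, Option.some.injEq, Prod.mk.injEq] at h
    · rw [← h.2, step]
    · rw [← h.2, step]

/-- Let `T` be a reversible G-automaton with a non-bi-reversible
connected component with state set `P`. Then `{𝐪∘ ∣ 𝐪 ∈ Q⁺}` does not contain the
inverse of `p∘` for any `p ∈ P` (i.e. no `𝐪 ∈ Q⁺` acts as a two-sided inverse of
`p∘` on `Σ*`). -/
theorem no_inverse_in_semigroup {Q A : Type*} [Fintype Q] [Fintype A] [Nonempty A]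
    (δ : Q → A → Option (A × Q)) (hG : GAutomaton δ) (hRev : Reversible δ)
    (P : Set Q) (hP : IsComponent δ P) (hPnbr : ¬ SubBiReversible δ P) :
    ¬ ∃ p ∈ P, ∃ l : List Q, l ≠ [] ∧
      ∀ u : List A, seqAct δ ([p] ++ l) u = some u ∧ seqAct δ (l ++ [p]) u = some u := by
  rintro ⟨p, hpP, l, -, hl⟩
  obtain ⟨hC, hI⟩ := hG
  have hex : ∀ q a, ∃ bp : A × Q, δ q a = some bp := fun q a => Option.isSome_iff_exists.1 (hC q a)
  choose tr htr using hex
  let out : Q → A → A := fun q a => (tr q a).1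
  let nxt : Q → A → Q := fun q a => (tr q a).2
  have hδ : ∀ q a, δ q a = some (out q a, nxt q a) := htr
  clear_value out nxt
  have hout : ∀ q, Function.Injective (out q) := fun q a a' h =>
    (hI q (out q a')).unique ⟨nxt q a, by rw [hδ, h]⟩ ⟨nxt q a', hδ q a'⟩
  have hnxt : ∀ a, Function.Injective fun q => nxt q a := fun a q q' h =>
    hRev a (nxt q' a) q _ q' _ ((hδ q a).trans (by rw [show nxt q a = nxt q' a from h])) (hδ q' a)
  have hinv : ∀ q b, ∃ a, out q a = b := by
    intro q b
    obtain ⟨a, ⟨r, h⟩, -⟩ := hI q b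
    rw [hδ, Option.some.injEq, Prod.mk.injEq] at h
    exact ⟨a, h.1⟩
  choose inv hinv using hinv
  have inv_out : ∀ q a, inv q (out q a) = a := fun q a => hout q (hinv q _)
  -- the sequences of the given length acting as the identity are permuted by every letter
  let S : Set (List Q) := {w | w.length = l.length + 1 ∧ ∀ u, seqAct δ w u = some u}
  have hSfin : S.Finite := (List.finite_length_eq Q (l.length + 1)).subset fun w hw => hw.1
  have hSbij : ∀ b, Set.BijOn (fun w => (stepSeq out nxt w b).2) S S := fun b =>
    (hSfin.injOn_iff_bijOn_of_mapsTo fun w hw =>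
      ⟨(length_stepSeq_snd w b).trans hw.1, (stepSeq_of_seqAct_eq_id hδ hw.2 b).2⟩).1
      (stepSeq_snd_injective hnxt b).injOn
  -- on their first entries a letter acts as in the inverse automaton
  have hhead : ∀ q m b, q :: m ∈ S →
      (stepSeq out nxt (q :: m) b).2 = nxt q (inv q b) :: (stepSeq out nxt m b).2 := by
    intro q m b h
    have hb : out q (stepSeq out nxt m b).1 = b := (stepSeq_of_seqAct_eq_id hδ h.2 b).1
    have hc := inv_out q (stepSeq out nxt m b).1
    rw [hb] at hc
    rw [stepSeq, hc]
  let R : Set Q := {q | ∃ m, q :: m ∈ S}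
  have hRmaps : ∀ b, Set.MapsTo (fun q => nxt q (inv q b)) R R := by
    rintro b q ⟨m, hm⟩
    exact ⟨_, hhead q m b hm ▸ (hSbij b).mapsTo hm⟩
  have hRsurj : ∀ b, Set.SurjOn (fun q => nxt q (inv q b)) R R := by
    rintro b q ⟨m, hm⟩
    obtain ⟨w, hw, e⟩ := (hSbij b).surjOn hm
    obtain _ | ⟨r, k⟩ := w
    · exact absurd hw.1 (by simp)
    · exact ⟨r, ⟨k, hw⟩, (List.cons.inj ((hhead r k b hw).symm.trans e)).1⟩
  have hRinj : ∀ b, Set.InjOn (fun q => nxt q (inv q b)) R := fun b =>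
    ((R.toFinite.surjOn_iff_bijOn_of_mapsTo (hRmaps b)).1 (hRsurj b)).injOn
  have hRclosed : ∀ q ∈ R, ∀ a, nxt q a ∈ R := by
    intro q hq a
    have h := hRmaps (out q a) hq
    simpa only [inv_out] using h
  have hpR : p ∈ R := ⟨l, by simp, fun u => (hl u).1⟩
  obtain ⟨q₀, rfl⟩ := hP
  have hq₀ := (mem_of_reflTransGen_adj hδ hnxt hRclosed hpP).2 hpR
  have hPR : ∀ q, Relation.ReflTransGen (Adj δ) q₀ q → q ∈ R := fun q hq =>
    (mem_of_reflTransGen_adj hδ hnxt hRclosed hq).1 hq₀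
  refine hPnbr ⟨fun a r _ q₁ b₁ q₂ b₂ _ _ => hRev a r q₁ b₁ q₂ b₂, ?_⟩
  intro b r _ q₁ a₁ q₂ a₂ hq₁ hq₂ h₁ h₂
  rw [hδ, Option.some.injEq, Prod.mk.injEq] at h₁ h₂
  obtain ⟨rfl, rfl⟩ := h₁
  have hq : q₁ = q₂ := hRinj (out q₁ a₁) (hPR q₁ hq₁) (hPR q₂ hq₂) (by
    change nxt q₁ (inv q₁ (out q₁ a₁)) = nxt q₂ (inv q₂ (out q₁ a₁))
    rw [inv_out, ← h₂.1, inv_out, h₂.2])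
  subst hq
  exact ⟨rfl, (hout q₁ h₂.1).symm⟩

end AutOrbit
end

section
/- Let T = (Q, Σ, δ) be a reversible G-automaton and let P be the state set of some non-bi-reversible connected component of T. Then P contains at least two elements, and for every 𝐪 ∈ Q* and p ∈ P the bijection 𝐪p∘ has no inverse in S(T), i.e. there is no 𝐫 ∈ Q⁺ with 𝐫𝐪p∘ equal to the identity on Σ*. In particular, every such element 𝐪p∘ is torsion-free, i.e. has infinite order in the automaton group G(T). -/
/- Common framework for automaton semigroups acting on finite and infinite words.

An S-automaton over states `Q` and alphabet `A` is given by a partial deterministic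
transition function `δ : Q → A → Option (A × Q)` (with `δ q a = some (b, p)` encoding
the transition `q –a/b→ p`). -/

namespace AutOrbit

variable {Q A : Type*}

/-- Output letter of a state sequence on an input letter, for total output and transition
functions `out` and `nxt`. -/
def outSeq (out : Q → A → A) (l : List Q) (a : A) : A := l.foldr out a

/-- Residual of a state sequence after reading a letter, for total output and transition
functions `out` and `nxt`. -/
def nextSeq (out : Q → A → A) (nxt : Q → A → Q) : List Q → A → List Q
  | [], _ => []
  | q :: l, a => nxt q (outSeq out l a) :: nextSeq out nxt l a

/-- A state sequence acts as the identity on all finite words. -/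
def ActsAsId (δ : Q → A → Option (A × Q)) (l : List Q) : Prop :=
  ∀ u : List A, seqAct δ l u = some u

theorem GAutomaton.exists_total {δ : Q → A → Option (A × Q)}
    (hG : GAutomaton δ) :
    ∃ (out : Q → A → A) (nxt : Q → A → Q), ∀ q a, δ q a = some (out q a, nxt q a) :=
  ⟨fun q a => ((δ q a).get (hG.1 q a)).1, fun q a => ((δ q a).get (hG.1 q a)).2, by simp⟩

section Total

variable {δ : Q → A → Option (A × Q)} {out : Q → A → A} {nxt : Q → A → Q}

theorem outSeq_append_singleton (t : List Q) (q : Q) (a : A) :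
    outSeq out (t ++ [q]) a = outSeq out t (out q a) := by
  simp [outSeq]

theorem nextSeq_append_singleton (t : List Q) (q : Q) (a : A) :
    nextSeq out nxt (t ++ [q]) a = nextSeq out nxt t (out q a) ++ [nxt q a] := by
  induction t with
  | nil => rfl
  | cons r t ih => simp [nextSeq, ih, outSeq_append_singleton]

theorem length_nextSeq (l : List Q) (a : A) : (nextSeq out nxt l a).length = l.length := by
  induction l with
  | nil => rfl
  | cons q l ih => simp [nextSeq, ih]

theorem nextSeq_injective (hinj : ∀ a, Function.Injective fun q => nxt q a) (a : A) :
    Function.Injective fun l => nextSeq out nxt l a := by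
  intro l
  induction l with
  | nil =>
    rintro (_ | ⟨r, m⟩) h
    · rfl
    · simp [nextSeq] at h
  | cons q l ih =>
    rintro (_ | ⟨r, m⟩) h
    · simp [nextSeq] at h
    · simp only [nextSeq, List.cons.injEq] at h
      obtain rfl := ih h.2
      rw [hinj _ h.1]

theorem seqAct_cons_letter (hδ : ∀ q a, δ q a = some (out q a, nxt q a)) (l : List Q)
    (a : A) (u : List A) :
    seqAct δ l (a :: u) =
      (seqAct δ (nextSeq out nxt l a) u).map (outSeq out l a :: ·) := by
  induction l with
  | nil => rfl
  | cons q l ih =>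
    have step : seqAct δ (q :: l) (a :: u) =
        (seqAct δ l (a :: u)).bind (stateAct δ q) := rfl
    have step' : seqAct δ (nextSeq out nxt (q :: l) a) u =
        (seqAct δ (nextSeq out nxt l a) u).bind
          (stateAct δ (nxt q (outSeq out l a))) := rfl
    rw [step, step', ih]
    cases seqAct δ (nextSeq out nxt l a) u with
    | none => rfl
    | some v => simp [stateAct, hδ, outSeq]

theorem ActsAsId.outSeq_eq (hδ : ∀ q a, δ q a = some (out q a, nxt q a)) {l : List Q}
    (h : ActsAsId δ l) (a : A) : outSeq out l a = a := by
  have h' := h [a]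
  rw [seqAct_cons_letter hδ, Option.map_eq_some_iff] at h'
  obtain ⟨v, -, hv⟩ := h'
  exact (List.cons.inj hv).1

theorem ActsAsId.nextSeq (hδ : ∀ q a, δ q a = some (out q a, nxt q a)) {l : List Q}
    (h : ActsAsId δ l) (a : A) : ActsAsId δ (nextSeq out nxt l a) := by
  intro u
  have h' := h (a :: u)
  rw [seqAct_cons_letter hδ, Option.map_eq_some_iff] at h'
  obtain ⟨v, hv, hvu⟩ := h'
  rw [hv, (List.cons.inj hvu).2]

/-- Reading a letter permutes the sequences of a fixed length that act as the identity. -/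
theorem ActsAsId.exists_nextSeq_eq [Finite Q]
    (hδ : ∀ q a, δ q a = some (out q a, nxt q a))
    (hinj : ∀ a, Function.Injective fun q => nxt q a) {l : List Q} (h : ActsAsId δ l)
    (a : A) : ∃ m, ActsAsId δ m ∧ AutOrbit.nextSeq out nxt m a = l := by
  let S : Set (List Q) := {m | m.length = l.length ∧ ActsAsId δ m}
  have hS : S.Finite := (List.finite_length_eq Q l.length).subset fun m hm => hm.1
  have hmaps : Set.MapsTo (fun m => AutOrbit.nextSeq out nxt m a) S S := fun m hm =>
    ⟨(length_nextSeq m a).trans hm.1, hm.2.nextSeq hδ a⟩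
  obtain ⟨m, hm, hml⟩ :=
    ((hS.injOn_iff_bijOn_of_mapsTo hmaps).1 (nextSeq_injective hinj a).injOn).surjOn
      ⟨rfl, h⟩
  exact ⟨m, hm.2, hml⟩

/-- If `t p` acts as the identity and `q` moves to `p` on reading `a`, then some `s q` acting
as the identity moves to `t p` on reading `a`. -/
theorem ActsAsId.exists_predecessor [Finite Q]
    (hδ : ∀ q a, δ q a = some (out q a, nxt q a))
    (hinj : ∀ a, Function.Injective fun q => nxt q a) {t : List Q} {q : Q} {a : A}
    (h : ActsAsId δ (t ++ [nxt q a])) :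
    ∃ s, ActsAsId δ (s ++ [q]) ∧ AutOrbit.nextSeq out nxt s (out q a) = t := by
  obtain ⟨m, hm, hmt⟩ := h.exists_nextSeq_eq hδ hinj a
  obtain rfl | ⟨s, e, rfl⟩ := m.eq_nil_or_concat'
  · simp [AutOrbit.nextSeq] at hmt
  · rw [nextSeq_append_singleton] at hmt
    obtain ⟨ht, he⟩ := List.append_inj' hmt rfl
    obtain rfl := hinj a (List.cons.inj he).1
    exact ⟨s, hm, ht⟩

/-- Whether a state is the first-applied state of a sequence acting as the identity only
depends on its connected component. -/
theorem exists_actsAsId_iff_of_reachable [Finite Q]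
    (hδ : ∀ q a, δ q a = some (out q a, nxt q a))
    (hinj : ∀ a, Function.Injective fun q => nxt q a) {q p : Q}
    (hqp : Relation.ReflTransGen (Adj δ) q p) :
    (∃ t, ActsAsId δ (t ++ [q])) ↔ ∃ t, ActsAsId δ (t ++ [p]) := by
  have edge : ∀ q a, (∃ t, ActsAsId δ (t ++ [q])) ↔ ∃ t, ActsAsId δ (t ++ [nxt q a]) := by
    refine fun q a => ⟨fun ⟨t, ht⟩ => ?_, fun ⟨t, ht⟩ => ?_⟩
    · exact ⟨_, nextSeq_append_singleton t q a ▸ ht.nextSeq hδ a⟩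
    · obtain ⟨t', ht', -⟩ := ht.exists_predecessor hδ hinj
      exact ⟨t', ht'⟩
  induction hqp with
  | refl => rfl
  | tail _ hadj ih =>
    refine ih.trans ?_
    rcases hadj with ⟨a, b, h⟩ | ⟨a, b, h⟩ <;>
    · rw [hδ] at h
      obtain ⟨-, rfl⟩ := Prod.mk.inj (Option.some.inj h)
      simp only [← edge]

/-- If distinct states `q₁`, `q₂` have transitions with the same output letter and the same
target, then no sequence in which `q₁` is applied first acts as the identity. -/
theorem not_actsAsId_of_inverse_collision [Finite Q]
    (hδ : ∀ q a, δ q a = some (out q a, nxt q a))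
    (hinj : ∀ a, Function.Injective fun q => nxt q a) {q₁ q₂ : Q} {a₁ a₂ : A}
    (hne : q₁ ≠ q₂) (hout : out q₁ a₁ = out q₂ a₂) (hnxt : nxt q₁ a₁ = nxt q₂ a₂)
    (t : List Q) : ¬ ActsAsId δ (t ++ [q₁]) := by
  intro h
  have hnext := h.nextSeq hδ a₁
  rw [nextSeq_append_singleton, hnxt] at hnext
  obtain ⟨t', ht', heq⟩ := hnext.exists_predecessor hδ hinj
  rw [hout] at heq
  obtain rfl := nextSeq_injective hinj _ heq
  have h₁ := h.outSeq_eq hδ a₁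
  have h₂ := ht'.outSeq_eq hδ a₂
  rw [outSeq_append_singleton] at h₁ h₂
  obtain rfl : a₁ = a₂ := by rw [← h₁, ← h₂, hout]
  exact hne (hinj a₁ hnxt)

end Total

theorem listPow_succ (l : List Q) (i : ℕ) :
    listPow l (i + 1) = listPow l i ++ l := by
  simp [listPow, List.replicate_succ']

/-- Let `T` be a reversible G-automaton and `P` the state set of a
non-bi-reversible connected component. Then `P` has at least two elements, no element
`𝐪p∘` (`𝐪 ∈ Q*`, `p ∈ P`) has an inverse in `S(T)` (no `𝐫 ∈ Q⁺` with `𝐫𝐪p∘ = id`), and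
every such element is torsion-free, i.e. has infinite order in `G(T)` (no positive power
of `𝐪p∘` is the identity on `Σ*`). -/
theorem nonBireversible_component_torsionFree {Q A : Type*} [Fintype Q] [Fintype A]
    [Nonempty A] (δ : Q → A → Option (A × Q)) (hG : GAutomaton δ) (hRev : Reversible δ)
    (P : Set Q) (hP : IsComponent δ P) (hPnbr : ¬ SubBiReversible δ P) :
    (∃ p₁ ∈ P, ∃ p₂ ∈ P, p₁ ≠ p₂) ∧
    ∀ q : List Q, ∀ p ∈ P,
      (¬ ∃ r : List Q, r ≠ [] ∧ ∀ u : List A, seqAct δ (r ++ q ++ [p]) u = some u) ∧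
      (∀ i : ℕ, 1 ≤ i → ¬ ∀ u : List A, seqAct δ (listPow (q ++ [p]) i) u = some u) := by
  obtain ⟨out, nxt, hδ⟩ := hG.exists_total
  have hinj : ∀ a, Function.Injective fun q => nxt q a := fun a q₁ q₂ h =>
    hRev a (nxt q₂ a) q₁ _ q₂ _ ((hδ q₁ a).trans (by rw [show nxt q₁ a = nxt q₂ a from h]))
      (hδ q₂ a)
  obtain ⟨q₁, hq₁, q₂, hq₂, a₁, a₂, hne, hout, hnxt⟩ : ∃ q₁ ∈ P, ∃ q₂ ∈ P, ∃ a₁ a₂,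
      q₁ ≠ q₂ ∧ out q₁ a₁ = out q₂ a₂ ∧ nxt q₁ a₁ = nxt q₂ a₂ := by
    by_contra! hcon
    refine hPnbr ⟨fun a p _ q₁ b₁ q₂ b₂ _ _ => hRev a p q₁ b₁ q₂ b₂,
      fun b p _ q₁ a₁ q₂ a₂ hq₁ hq₂ h₁ h₂ => ?_⟩
    have h₁' := h₁
    have h₂' := h₂
    rw [hδ] at h₁' h₂'
    obtain ⟨hb₁, hp₁⟩ := Prod.mk.inj (Option.some.inj h₁')
    obtain ⟨hb₂, hp₂⟩ := Prod.mk.inj (Option.some.inj h₂')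
    have hq : q₁ = q₂ := by
      by_contra hq
      exact hcon q₁ hq₁ q₂ hq₂ a₁ a₂ hq (hb₁.trans hb₂.symm) (hp₁.trans hp₂.symm)
    subst hq
    exact ⟨rfl, (hG.2 q₁ b).unique ⟨p, h₁⟩ ⟨p, h₂⟩⟩
  have hno : ∀ p ∈ P, ∀ t, ¬ ActsAsId δ (t ++ [p]) := by
    obtain ⟨q₀, rfl⟩ := hP
    intro p hp t ht
    obtain ⟨t', ht'⟩ := (exists_actsAsId_iff_of_reachable hδ hinj hq₁).1
      ((exists_actsAsId_iff_of_reachable hδ hinj hp).2 ⟨t, ht⟩)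
    exact not_actsAsId_of_inverse_collision hδ hinj hne hout hnxt t' ht'
  refine ⟨⟨q₁, hq₁, q₂, hq₂, hne⟩, fun q p hp => ⟨fun ⟨r, _, hr⟩ => hno p hp _ hr, ?_⟩⟩
  intro i hi h
  obtain ⟨j, rfl⟩ := Nat.exists_eq_add_of_le' hi
  rw [listPow_succ, ← List.append_assoc] at h
  exact hno p hp _ h

end AutOrbit
end

section
/- Let T = (Q, Σ, δ) be an S-automaton. If there is an ω-word ξ ∈ Σ^ω whose orbit Q*∘ξ is finite, then there exist u ∈ Σ* and v ∈ Σ⁺ such that the orbit Q*∘(uv^ω) is finite, and v can be chosen so that it contains every letter that occurs infinitely often in ξ. If, in addition, T is complete and reversible, then v can moreover be chosen so that already the orbit Q*∘(v^ω) of the periodic word v^ω is finite. -/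
/- Common framework for automaton semigroups acting on finite and infinite words.

An S-automaton over states `Q` and alphabet `A` is given by a partial deterministic
transition function `δ : Q → A → Option (A × Q)` (with `δ q a = some (b, p)` encoding
the transition `q –a/b→ p`). -/

namespace AutOrbit

variable {Q A : Type*}

/-- `s` is the sequence of states visited while reading `η` and writing `ζ`. -/
def IsRun (δ : Q → A → Option (A × Q)) (s : ℕ → Q) (η ζ : ℕ → A) : Prop :=
  ∀ n, δ (s n) (η n) = some (ζ n, s (n + 1))

/-- The state `q` maps the ω-word `η` to the ω-word `ζ`. -/
def ActsTo (δ : Q → A → Option (A × Q)) (q : Q) (η ζ : ℕ → A) : Prop :=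
  ∀ n, stateAct δ q (pre η n) = some (pre ζ n)

/-- The state reached from `q` after reading `n` letters of `η`. -/
def stateAt (δ : Q → A → Option (A × Q)) (q : Q) (η : ℕ → A) : ℕ → Option Q
  | 0 => some q
  | n + 1 => (stateAt δ q η n).bind fun p => (δ p (η n)).map Prod.snd

/-- The position in an ω-word at which `n` lands when running into a loop from `j` to `i`. -/
def loopIndex (i j n : ℕ) : ℕ := if n < i then n else i + (n - i) % (j - i)

theorem pre_succ_s17 (η : ℕ → A) (n : ℕ) : pre η (n + 1) = η 0 :: pre (fun k => η (k + 1)) n := by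
  simp [pre, List.ofFn_succ]

theorem pre_congr {η ζ : ℕ → A} {n : ℕ} (h : ∀ k < n, η k = ζ k) : pre η n = pre ζ n := by
  unfold pre
  congr 1
  funext k
  exact h k k.2

theorem eq_of_pre_eq {η ζ : ℕ → A} (h : ∀ n, pre η n = pre ζ n) : η = ζ := by
  funext n
  have := List.ofFn_injective (h (n + 1))
  exact congrFun this ⟨n, Nat.lt_succ_self n⟩

theorem ActsTo.eq {δ : Q → A → Option (A × Q)} {q : Q} {η ζ θ : ℕ → A}
    (h : ActsTo δ q η ζ) (h' : ActsTo δ q η θ) : ζ = θ :=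
  eq_of_pre_eq fun n => Option.some_injective _ ((h n).symm.trans (h' n))

theorem IsRun.actsTo {δ : Q → A → Option (A × Q)} {s : ℕ → Q} {η ζ : ℕ → A}
    (h : IsRun δ s η ζ) : ActsTo δ (s 0) η ζ := by
  intro n
  induction n generalizing s η ζ with
  | zero => simp [pre, stateAct]
  | succ n ih =>
    have hs : IsRun δ (fun k => s (k + 1)) (fun k => η (k + 1)) (fun k => ζ (k + 1)) :=
      fun k => h (k + 1)
    have := ih hs
    simp only [zero_add] at this
    simp [pre_succ_s17, stateAct, h 0, this]

theorem stateAt_succ (δ : Q → A → Option (A × Q)) (q : Q) (η : ℕ → A) (n : ℕ) :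
    stateAt δ q η (n + 1) =
      (δ q (η 0)).bind fun bp => stateAt δ bp.2 (fun k => η (k + 1)) n := by
  induction n with
  | zero => cases h : δ q (η 0) <;> simp [stateAt, h]
  | succ n ih =>
    rw [stateAt, ih]
    cases h : δ q (η 0) <;> simp [stateAt]

theorem isSome_stateAt (δ : Q → A → Option (A × Q)) (q : Q) (η : ℕ → A) (n : ℕ) :
    (stateAt δ q η n).isSome = (stateAct δ q (pre η n)).isSome := by
  induction n generalizing q η with
  | zero => simp [stateAt, stateAct, pre]
  | succ n ih =>
    rw [stateAt_succ, pre_succ_s17, stateAct]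
    cases h : δ q (η 0) <;> simp [ih]

theorem exists_isRun {δ : Q → A → Option (A × Q)} {q : Q} {η : ℕ → A}
    (h : ∀ n, (stateAct δ q (pre η n)).isSome) : ∃ s ζ, s 0 = q ∧ IsRun δ s η ζ := by
  have hs : ∀ n, ∃ p, stateAt δ q η n = some p := fun n =>
    Option.isSome_iff_exists.1 ((isSome_stateAt δ q η n).trans (h n))
  choose s hs using hs
  have hr : ∀ n, ∃ b, δ (s n) (η n) = some (b, s (n + 1)) := by
    intro n
    have := hs (n + 1)
    simpa [stateAt, hs n] using this
  choose ζ hζ using hr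
  exact ⟨s, ζ, by simpa [stateAt] using (hs 0).symm, hζ⟩

theorem exists_seqAct_eq_pre {δ : Q → A → Option (A × Q)} {l : List Q} {ξ : ℕ → A}
    (h : ∀ n, (seqAct δ l (pre ξ n)).isSome) :
    ∃ η, ∀ n, seqAct δ l (pre ξ n) = some (pre η n) := by
  induction l with
  | nil => exact ⟨ξ, fun n => rfl⟩
  | cons q l ih =>
    obtain ⟨η, hη⟩ := ih fun n => by
      have := h n
      rw [seqAct_cons] at this
      exact Option.isSome_of_isSome_bind this
    obtain ⟨s, ζ, rfl, hr⟩ := exists_isRun (δ := δ) (q := q) (η := η) fun n => by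
      simpa [seqAct_cons, hη n] using h n
    exact ⟨ζ, fun n => by simpa [seqAct_cons, hη n] using hr.actsTo n⟩

theorem omegaOrbit_subset {δ : Q → A → Option (A × Q)} {S : Set (ℕ → A)} {ξ : ℕ → A}
    (hξ : ξ ∈ S) (hS : ∀ η ∈ S, ∀ q ζ, ActsTo δ q η ζ → ζ ∈ S) :
    omegaOrbit δ Set.univ ξ ⊆ S := by
  rintro η ⟨l, -, hl⟩
  induction l generalizing η with
  | nil =>
    have : ξ = η := eq_of_pre_eq fun n => Option.some_injective _ (hl n)
    exact this ▸ hξ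
  | cons q l ih =>
    obtain ⟨ζ, hζ⟩ := exists_seqAct_eq_pre (δ := δ) (l := l) (ξ := ξ) fun n => by
      have := hl n
      rw [seqAct_cons] at this
      exact Option.isSome_of_isSome_bind (by rw [this]; rfl)
    exact hS ζ (ih hζ) q η fun n => by simpa [seqAct_cons, hζ n] using hl n

theorem mem_omegaOrbit_self (δ : Q → A → Option (A × Q)) (ξ : ℕ → A) :
    ξ ∈ omegaOrbit δ Set.univ ξ :=
  ⟨[], trivial, fun _ => rfl⟩

theorem ActsTo.mem_omegaOrbit {δ : Q → A → Option (A × Q)} {ξ η ζ : ℕ → A} {q : Q}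
    (h : ActsTo δ q η ζ) (hη : η ∈ omegaOrbit δ Set.univ ξ) :
    ζ ∈ omegaOrbit δ Set.univ ξ := by
  obtain ⟨l, -, hl⟩ := hη
  exact ⟨q :: l, trivial, fun n => by simpa [seqAct_cons, hl n] using h n⟩

theorem loopIndex_of_lt {i j n : ℕ} (h : n < i) : loopIndex i j n = n := if_pos h

theorem loopIndex_zero (i j : ℕ) : loopIndex i j 0 = 0 := by
  rcases i.eq_zero_or_pos with rfl | hi
  · simp [loopIndex]
  · exact loopIndex_of_lt hi

theorem loopIndex_self (i j : ℕ) : loopIndex i j i = i := by simp [loopIndex]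

theorem loopIndex_add (i j n : ℕ) : loopIndex i j (i + n) = i + n % (j - i) := by
  simp [loopIndex]

theorem apply_loopIndex_succ {α : Type*} {s : ℕ → α} {i j : ℕ} (hij : i < j) (hs : s i = s j)
    (n : ℕ) : s (loopIndex i j (n + 1)) = s (loopIndex i j n + 1) := by
  rcases lt_or_ge n i with hn | hn
  · rw [loopIndex_of_lt hn]
    rcases Nat.lt_or_ge (n + 1) i with h | h
    · rw [loopIndex_of_lt h]
    · obtain rfl : n + 1 = i := by omega
      simp [loopIndex]
  · obtain ⟨m, rfl⟩ := Nat.exists_eq_add_of_le hn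
    rw [add_assoc, loopIndex_add, loopIndex_add, ← Nat.mod_add_mod]
    have hlt : m % (j - i) + 1 ≤ j - i := Nat.mod_lt m (by omega)
    rcases hlt.lt_or_eq with h | h
    · rw [Nat.mod_eq_of_lt h, add_assoc]
    · have hj : i + m % (j - i) + 1 = j := by omega
      rw [h, Nat.mod_self, hj, add_zero, hs]

theorem IsRun.loop {δ : Q → A → Option (A × Q)} {s : ℕ → Q} {η ζ : ℕ → A}
    (h : IsRun δ s η ζ) {i j : ℕ} (hij : i < j) (hs : s i = s j) :
    IsRun δ (s ∘ loopIndex i j) (η ∘ loopIndex i j) (ζ ∘ loopIndex i j) := by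
  intro n
  have := h (loopIndex i j n)
  rwa [← apply_loopIndex_succ hij hs] at this

theorem ultPer_eq_loop (ξ : ℕ → A) {i j : ℕ} (hij : i < j) :
    ultPer (pre ξ i) (ξ i) (pre (fun k => ξ (i + 1 + k)) (j - i - 1)) = ξ ∘ loopIndex i j := by
  have hc : ξ i :: pre (fun k => ξ (i + 1 + k)) (j - i - 1) = pre (fun k => ξ (i + k)) (j - i) := by
    obtain ⟨d, hd⟩ : ∃ d, j - i = d + 1 := ⟨j - i - 1, by omega⟩
    rw [hd, pre_succ_s17]
    simp [add_comm, add_left_comm]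
  funext n
  unfold ultPer
  simp only [hc]
  by_cases h : n < i
  · simp [pre, loopIndex, h]
  · have hlt : (n - i) % (j - i) < (pre (fun k => ξ (i + k)) (j - i)).length := by
      simpa [pre] using Nat.mod_lt _ (by omega)
    simpa [pre, loopIndex, h] using (List.getElem_of_eq hc.symm hlt).symm

theorem ultPer_nil_eq_loop (ξ : ℕ → A) {i j : ℕ} (hij : i < j) (n : ℕ) :
    ultPer [] (ξ i) (pre (fun k => ξ (i + 1 + k)) (j - i - 1)) n = ξ (loopIndex i j (i + n)) := by
  rw [← Function.comp_apply (f := ξ), ← ultPer_eq_loop ξ hij]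
  simp [ultPer, pre]

theorem stateAct_isSome_of_complete {δ : Q → A → Option (A × Q)} (hc : Complete δ) (q : Q)
    (u : List A) : (stateAct δ q u).isSome := by
  induction u generalizing q with
  | nil => rfl
  | cons a u ih =>
    obtain ⟨bp, h⟩ := Option.isSome_iff_exists.1 (hc q a)
    simp [stateAct, h, ih]

theorem IsRun.eq_of_reversible {δ : Q → A → Option (A × Q)} (hr : Reversible δ)
    {s t : ℕ → Q} {η ζ θ : ℕ → A} (hs : IsRun δ s η ζ) (ht : IsRun δ t η θ) {n : ℕ}
    (h : s n = t n) : s 0 = t 0 := by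
  induction n with
  | zero => exact h
  | succ n ih => exact ih (hr (η n) (s (n + 1)) _ _ _ _ (hs n) (h ▸ ht n))

theorem exists_infinite_return {α : Type*} [Finite α] [Finite A] (c : ℕ → α) (ξ : ℕ → A)
    (N : ℕ) : ∃ i j, N ≤ i ∧ i < j ∧ c i = c j ∧
      ∀ a, {n : ℕ | ξ n = a}.Infinite → ∃ n, i ≤ n ∧ n < j ∧ ξ n = a := by
  have := Fintype.ofFinite A
  obtain ⟨y, hy⟩ := Finite.exists_infinite_fiber c
  have hy : (c ⁻¹' {y}).Infinite := Set.infinite_coe_iff.1 hy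
  obtain ⟨i, hi, hNi⟩ := hy.exists_gt N
  have hf : ∀ a, ∃ n, {n : ℕ | ξ n = a}.Infinite → i ≤ n ∧ ξ n = a := by
    intro a
    by_cases h : {n : ℕ | ξ n = a}.Infinite
    · obtain ⟨n, hn, hin⟩ := h.exists_gt i
      exact ⟨n, fun _ => ⟨hin.le, hn⟩⟩
    · exact ⟨0, fun h' => absurd h' h⟩
  choose f hf using hf
  obtain ⟨j, hj, hlt⟩ := hy.exists_gt (max i (Finset.univ.sup f))
  refine ⟨i, j, hNi.le, (le_max_left _ _).trans_lt hlt, Eq.trans hi hj.symm, fun a ha =>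
    ⟨f a, (hf a ha).1, ?_, (hf a ha).2⟩⟩
  exact ((Finset.le_sup (Finset.mem_univ a)).trans (le_max_right _ _)).trans_lt hlt

/-- If some ω-word `ξ` has a finite orbit `Q*∘ξ`, then there are
`u ∈ Σ*` and `v = a :: v' ∈ Σ⁺` such that `Q*∘(uv^ω)` is finite and `v` contains every
letter occurring infinitely often in `ξ`. If, in addition, `T` is complete and
reversible, then `u, v` can be chosen such that moreover already `Q*∘(v^ω)` is finite. -/
theorem finite_orbit_implies_ultimately_periodic_finite_orbit {Q A : Type*} [Fintype Q]
    [Fintype A] [Nonempty A] (δ : Q → A → Option (A × Q)) (ξ : ℕ → A)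
    (hfin : (omegaOrbit δ (Set.univ : Set (List Q)) ξ).Finite) :
    (∃ (u : List A) (a : A) (v' : List A),
      (omegaOrbit δ (Set.univ : Set (List Q)) (ultPer u a v')).Finite ∧
      ∀ c : A, {n : ℕ | ξ n = c}.Infinite → c ∈ (a :: v')) ∧
    (Complete δ → Reversible δ →
      ∃ (u : List A) (a : A) (v' : List A),
        (omegaOrbit δ (Set.univ : Set (List Q)) (ultPer u a v')).Finite ∧
        (∀ c : A, {n : ℕ | ξ n = c}.Infinite → c ∈ (a :: v')) ∧
        (omegaOrbit δ (Set.univ : Set (List Q)) (ultPer [] a v')).Finite) := by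
  have hO := hfin.to_subtype
  set O := omegaOrbit δ (Set.univ : Set (List Q)) ξ
  have hrun : ∀ (η : O) (q : Q), ∃ s : ℕ → Q, ∃ N : ℕ,
      (∃ ζ, s 0 = q ∧ IsRun δ s η ζ) ∨ stateAct δ q (pre η N) = none := by
    intro η q
    by_cases h : ∀ n, (stateAct δ q (pre η n)).isSome
    · obtain ⟨s, ζ, hs⟩ := exists_isRun h
      exact ⟨s, 0, Or.inl ⟨ζ, hs⟩⟩
    · push Not at h
      obtain ⟨n, hn⟩ := h
      exact ⟨fun _ => q, n, Or.inr (by simpa using hn)⟩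
  choose s N hsN using hrun
  obtain ⟨M, hM⟩ : ∃ M, ∀ η q, N η q ≤ M := by
    obtain ⟨M, hM⟩ := (Set.finite_range fun x : O × Q => N x.1 x.2).bddAbove
    exact ⟨M, fun η q => hM ⟨(η, q), rfl⟩⟩
  obtain ⟨i, j, hMi, hij, hc, hletters⟩ := exists_infinite_return (fun n η q => s η q n) ξ M
  have hs : ∀ η q, s η q i = s η q j := fun η q => congrFun (congrFun hc η) q
  have hfinite : (omegaOrbit δ Set.univ (ξ ∘ loopIndex i j)).Finite := by
    refine (hfin.image fun η => η ∘ loopIndex i j).subset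
      (omegaOrbit_subset ⟨ξ, mem_omegaOrbit_self δ ξ, rfl⟩ ?_)
    rintro _ ⟨η, hη, rfl⟩ q θ hθ
    rcases hsN ⟨η, hη⟩ q with ⟨ζ, h0, hζ⟩ | hdead
    · have hact := (hζ.loop hij (hs _ _)).actsTo
      rw [Function.comp_apply, loopIndex_zero, h0] at hact
      exact ⟨ζ, (h0 ▸ hζ.actsTo).mem_omegaOrbit hη, hact.eq hθ⟩
    · have := hθ (N ⟨η, hη⟩ q)
      rw [pre_congr (ζ := η) fun k hk => by
        simp [loopIndex_of_lt (hk.trans_le ((hM ⟨η, hη⟩ q).trans hMi))], hdead] at this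
      cases this
  have hmem : ∀ c : A, {n : ℕ | ξ n = c}.Infinite →
      c ∈ ξ i :: pre (fun k => ξ (i + 1 + k)) (j - i - 1) := by
    intro c hinf
    obtain ⟨n, hin, hnj, rfl⟩ := hletters c hinf
    rcases hin.eq_or_lt with rfl | hlt
    · exact List.mem_cons_self
    · refine List.mem_cons_of_mem _ (List.mem_ofFn.2 ⟨⟨n - (i + 1), by omega⟩, ?_⟩)
      exact congrArg ξ (by simp only; omega)
  rw [← ultPer_eq_loop ξ hij] at hfinite
  refine ⟨⟨_, _, _, hfinite, hmem⟩, fun hcomp hrev => ⟨_, _, _, hfinite, hmem, ?_⟩⟩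
  have halive : ∀ η q, ∃ ζ, s η q 0 = q ∧ IsRun δ (s η q) η ζ := fun η q =>
    (hsN η q).resolve_right fun h => by
      simpa [h] using stateAct_isSome_of_complete hcomp q (pre η (N η q))
  refine (hfin.image fun η n => η (loopIndex i j (i + n))).subset
    (omegaOrbit_subset ⟨ξ, mem_omegaOrbit_self δ ξ, funext fun n =>
      (ultPer_nil_eq_loop ξ hij n).symm⟩ ?_)
  rintro _ ⟨η, hη, rfl⟩ p θ hθ
  have hinj : Function.Injective fun q => s ⟨η, hη⟩ q i := by
    intro q r hqr
    obtain ⟨_, hq, hq'⟩ := halive ⟨η, hη⟩ q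
    obtain ⟨_, hr, hr'⟩ := halive ⟨η, hη⟩ r
    rw [← hq, ← hr]
    exact hq'.eq_of_reversible hrev hr' hqr
  obtain ⟨q, rfl⟩ := Finite.surjective_of_injective hinj p
  obtain ⟨ζ, h0, hζ⟩ := halive ⟨η, hη⟩ q
  have hshift : IsRun δ (fun n => s ⟨η, hη⟩ q (loopIndex i j (i + n)))
      (fun n => η (loopIndex i j (i + n))) (fun n => ζ (loopIndex i j (i + n))) :=
    fun n => hζ.loop hij (hs _ _) (i + n)
  have hact := hshift.actsTo
  rw [add_zero, loopIndex_self] at hact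
  exact ⟨ζ, (h0 ▸ hζ.actsTo).mem_omegaOrbit hη, hact.eq hθ⟩

end AutOrbit
end
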